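/- Let H : ℝ → ℝ be an even function with H ∈ L¹(ℝ) ∩ L²(ℝ) and 1 + Ĥ(k) > 0 for all k ∈ ℝ. Suppose Γ ∈ L¹((0,∞)) ∩ L^∞((0,∞)) satisfies Γ(t) + ∫₀^∞ H(t−u) Γ(u) du = H(t) for almost every t > 0, and for each x > 0 suppose Γ_x ∈ L²((0,x)) satisfies Γ_x(t) + ∫₀ˣ H(t−u) Γ_x(u) du = H(t) for almost every t ∈ (0,x). Then ∫₀ˣ |Γ_x(t) − Γ(t)|² dt → 0 as x → +∞. -/

import Mathlib

open MeasureTheory Set Filter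

open scoped FourierTransform Convolution ContDiff

/-- The Fourier transform on `L²` agrees a.e. with the Fourier integral on `L¹ ∩ L²`. -/
theorem MeasureTheory.MemLp.fourier_toLp_ae_eq {f : ℝ → ℂ} (hf1 : Integrable f)
    (hf2 : MemLp f 2) :
    (𝓕 (hf2.toLp f) : Lp ℂ 2 (volume : Measure ℝ)) =ᵐ[volume] 𝓕 f := by
  have hcont : Continuous (𝓕 f) :=
    VectorFourier.fourierIntegral_continuous Real.continuous_fourierChar
      continuous_inner hf1
  refine ae_eq_of_integral_contDiff_smul_eq
    ((Lp.memLp _).locallyIntegrable (by norm_num)) hcont.locallyIntegrable ?_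
  intro g hg hgc
  have hgc' : HasCompactSupport (fun x => (g x : ℂ)) := hgc.comp_left Complex.ofReal_zero
  have hg' : ContDiff ℝ ∞ (fun x => (g x : ℂ)) := Complex.ofRealCLM.contDiff.comp hg
  set φ := hgc'.toSchwartzMap hg'
  have hφx (x : ℝ) : φ x = (g x : ℂ) := rfl
  have hdist := congrArg (fun T => T φ)
    (Lp.fourier_toTemperedDistribution_eq (hf2.toLp f))
  simp only [TemperedDistribution.fourier_apply, Lp.toTemperedDistribution_apply] at hdist
  have hswap : ∫ ξ, 𝓕 (φ : ℝ → ℂ) ξ • f ξ = ∫ x, φ x • 𝓕 f x := by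
    simpa using! VectorFourier.integral_fourierIntegral_smul_eq_flip (L := innerₗ ℝ)
      Real.continuous_fourierChar continuous_inner φ.integrable hf1
  calc ∫ x, g x • (𝓕 (hf2.toLp f) : Lp ℂ 2 (volume : Measure ℝ)) x
      = ∫ x, φ x • (𝓕 (hf2.toLp f) : Lp ℂ 2 (volume : Measure ℝ)) x := by
        simp [hφx]
    _ = ∫ x, (𝓕 φ) x • (hf2.toLp f) x := hdist.symm
    _ = ∫ x, 𝓕 (φ : ℝ → ℂ) x • f x := by
        refine integral_congr_ae ?_
        filter_upwards [hf2.coeFn_toLp] with x hx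
        rw [hx, SchwartzMap.fourier_coe]
    _ = ∫ x, φ x • 𝓕 f x := hswap
    _ = ∫ x, g x • 𝓕 f x := by simp [hφx]

/-- **Plancherel's theorem** for functions in `L¹ ∩ L²`. -/
theorem integrable_inner_fourier_and_integral_eq {f g : ℝ → ℂ} (hf1 : Integrable f)
    (hf2 : MemLp f 2) (hg1 : Integrable g) (hg2 : MemLp g 2) :
    Integrable (fun ξ => inner ℂ (𝓕 f ξ) (𝓕 g ξ)) ∧
      ∫ ξ, inner ℂ (𝓕 f ξ) (𝓕 g ξ) = ∫ x, inner ℂ (f x) (g x) := by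
  have hae : (fun ξ => inner ℂ ((𝓕 (hf2.toLp f) : Lp ℂ 2 (volume : Measure ℝ)) ξ)
      ((𝓕 (hg2.toLp g) : Lp ℂ 2 (volume : Measure ℝ)) ξ)) =ᵐ[volume]
      fun ξ => inner ℂ (𝓕 f ξ) (𝓕 g ξ) := by
    filter_upwards [hf2.fourier_toLp_ae_eq hf1, hg2.fourier_toLp_ae_eq hg1] with ξ h1 h2
    rw [h1, h2]
  refine ⟨(L2.integrable_inner _ _).congr hae, ?_⟩
  rw [← integral_congr_ae hae, ← L2.inner_def, Lp.inner_fourier_eq, L2.inner_def]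
  refine integral_congr_ae ?_
  filter_upwards [hf2.coeFn_toLp, hg2.coeFn_toLp] with x h1 h2
  rw [h1, h2]

/-- Cauchy–Schwarz with respect to the weight `|k|`. -/
theorem integrable_mul_and_sq_integral_le {α : Type*} [MeasurableSpace α] {μ : Measure α}
    {f k : α → ℝ} (hf : AEStronglyMeasurable f μ) (hk : Integrable k μ)
    (hfk : Integrable (fun x => f x ^ 2 * |k x|) μ) :
    Integrable (fun x => f x * k x) μ ∧
      (∫ x, f x * k x ∂μ) ^ 2 ≤ (∫ x, |k x| ∂μ) * ∫ x, f x ^ 2 * |k x| ∂μ := by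
  have hint : Integrable (fun x => f x * k x) μ := by
    refine (hk.abs.add hfk).mono' (hf.mul hk.aestronglyMeasurable) (ae_of_all _ fun x => ?_)
    rw [Real.norm_eq_abs, abs_mul, Pi.add_apply]
    have h0 := abs_nonneg (k x)
    have h1 : |f x| ≤ 1 + f x ^ 2 := by
      nlinarith [sq_abs (f x), sq_nonneg (|f x| - 1), abs_nonneg (f x)]
    nlinarith
  refine ⟨hint, ?_⟩
  have habs : Integrable (fun x => |f x| * |k x|) μ := by
    simpa only [abs_mul] using hint.abs
  have hle : |∫ x, f x * k x ∂μ| ≤ ∫ x, |f x| * |k x| ∂μ := by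
    simpa only [abs_mul] using abs_integral_le_integral_abs (f := fun x => f x * k x) (μ := μ)
  have hquad (s : ℝ) : 0 ≤ (∫ x, |k x| ∂μ) * (s * s) +
      (-2 * ∫ x, |f x| * |k x| ∂μ) * s + ∫ x, f x ^ 2 * |k x| ∂μ := by
    have h0 : 0 ≤ ∫ x, (|k x| * (s * s) + (-2 * s) * (|f x| * |k x|) + f x ^ 2 * |k x|) ∂μ := by
      refine integral_nonneg fun x => ?_
      have : |k x| * (s * s) + (-2 * s) * (|f x| * |k x|) + f x ^ 2 * |k x| =
          |k x| * (|f x| - s) ^ 2 := by rw [← sq_abs (f x)]; ring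
      simp only [Pi.zero_apply]
      rw [this]
      positivity
    rw [integral_add (by fun_prop) hfk,
      integral_add (hk.abs.mul_const _) (habs.const_mul _), integral_mul_const,
      integral_const_mul] at h0
    linarith
  have hd := discrim_le_zero hquad
  rw [discrim] at hd
  have hsq : (∫ x, f x * k x ∂μ) ^ 2 ≤ (∫ x, |f x| * |k x| ∂μ) ^ 2 := by
    rw [← sq_abs]; gcongr
  nlinarith

/-- **Young's inequality** for the convolution of an `L²` function with an `L¹` function,
together with the a.e. existence of the convolution integral. -/
theorem memLp_two_convolution {f k : ℝ → ℝ} (hf : MemLp f 2) (hk : Integrable k) :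
    (∀ᵐ t, Integrable fun u => f u * k (t - u)) ∧
      MemLp (fun t => ∫ u, f u * k (t - u)) 2 ∧
      ∫ t, (∫ u, f u * k (t - u)) ^ 2 ≤ (∫ t, |k t|) ^ 2 * ∫ t, f t ^ 2 := by
  have hprod : Integrable (fun p : ℝ × ℝ => f p.2 ^ 2 * |k (p.1 - p.2)|)
      (volume.prod volume) := by
    simpa using hf.integrable_sq.convolution_integrand (.mul ℝ ℝ) hk.abs
  have hpt : ∀ᵐ t, Integrable (fun u => f u * k (t - u)) ∧
      (∫ u, f u * k (t - u)) ^ 2 ≤ (∫ t, |k t|) * ∫ u, f u ^ 2 * |k (t - u)| := by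
    filter_upwards [hprod.prod_right_ae] with t ht
    have := integrable_mul_and_sq_integral_le hf.aestronglyMeasurable (hk.comp_sub_left t) ht
    rwa [integral_sub_left_eq_self (fun u => |k u|) volume t] at this
  have hmeas : AEStronglyMeasurable (fun t => ∫ u, f u * k (t - u)) := by
    have := AEStronglyMeasurable.convolution_integrand (.mul ℝ ℝ) hf.aestronglyMeasurable
      hk.aestronglyMeasurable (μ := (volume : Measure ℝ)) (ν := volume)
    simpa using this.integral_prod_right'
  have hdom : Integrable fun t => (∫ t, |k t|) * ∫ u, f u ^ 2 * |k (t - u)| :=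
    hprod.integral_prod_left.const_mul _
  have hsq : Integrable fun t => (∫ u, f u * k (t - u)) ^ 2 := by
    refine hdom.mono' (hmeas.pow 2) ?_
    filter_upwards [hpt] with t ht
    rw [Real.norm_of_nonneg (sq_nonneg _)]
    exact ht.2
  refine ⟨hpt.mono fun t ht => ht.1, (memLp_two_iff_integrable_sq hmeas).2 hsq, ?_⟩
  calc ∫ t, (∫ u, f u * k (t - u)) ^ 2
      ≤ ∫ t, (∫ t, |k t|) * ∫ u, f u ^ 2 * |k (t - u)| :=
        integral_mono_ae hsq hdom (hpt.mono fun t ht => ht.2)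
    _ = (∫ t, |k t|) ^ 2 * ∫ t, f t ^ 2 := by
        rw [integral_const_mul]
        have := integral_convolution (.mul ℝ ℝ) (μ := (volume : Measure ℝ)) (ν := volume)
          hf.integrable_sq hk.abs
        simp only [convolution, ContinuousLinearMap.mul_apply'] at this
        rw [this]
        ring

theorem Real.re_fourier_ofReal {k : ℝ → ℝ} (hk : Integrable k) (ξ : ℝ) :
    (𝓕 (fun t => (k t : ℂ)) ξ).re = ∫ t, k t * Real.cos (2 * Real.pi * ξ * t) := by
  rw [Real.fourier_real_eq_integral_exp_smul]
  have hi : Integrable fun t : ℝ =>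
      Complex.exp (↑(-2 * Real.pi * t * ξ) * Complex.I) • (k t : ℂ) := by
    refine hk.ofReal.bdd_mul (c := 1) (by fun_prop) (ae_of_all _ fun t => ?_)
    rw [Complex.norm_exp_ofReal_mul_I]
  rw [← Complex.reCLM_apply, ← ContinuousLinearMap.integral_comp_comm _ hi]
  refine integral_congr_ae (ae_of_all _ fun t => ?_)
  simp only [Complex.reCLM_apply, smul_eq_mul, Complex.re_mul_ofReal,
    Complex.exp_ofReal_mul_I_re]
  rw [mul_comm, ← Real.cos_neg]
  ring_nf

/-- By the Riemann–Lebesgue lemma, pointwise positivity of the symbol is uniform. -/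
theorem exists_pos_le_one_add_re_fourier {k : ℝ → ℝ} (hk : Integrable k)
    (hpos : ∀ ξ : ℝ, 0 < 1 + ∫ t : ℝ, k t * Real.cos (ξ * t)) :
    ∃ c > 0, ∀ ξ : ℝ, c ≤ 1 + (𝓕 (fun t => (k t : ℂ)) ξ).re := by
  set m : ℝ → ℝ := fun ξ => 1 + (𝓕 (fun t => (k t : ℂ)) ξ).re with hm
  have hmpos (ξ : ℝ) : 0 < m ξ := by
    simp only [hm]
    rw [Real.re_fourier_ofReal hk]
    exact hpos _
  have hcont : Continuous m := by
    have : Continuous (𝓕 (fun t => (k t : ℂ))) :=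
      VectorFourier.fourierIntegral_continuous Real.continuous_fourierChar
        continuous_inner hk.ofReal
    fun_prop
  have hlim : Tendsto m (cocompact ℝ) (nhds 1) := by
    have h := Real.zero_at_infty_fourier (fun t => (k t : ℂ))
    simpa [hm] using ((Complex.continuous_re.tendsto 0).comp h).const_add 1
  obtain ⟨K, hK, hKsub⟩ := mem_cocompact.1
    (hlim.eventually_const_le (by norm_num : (1 / 2 : ℝ) < 1))
  obtain ⟨ξ₀, -, hξ₀⟩ := (hK.insert 0).exists_isMinOn (insert_nonempty 0 K) hcont.continuousOn
  refine ⟨min (1 / 2) (m ξ₀), lt_min (by norm_num) (hmpos ξ₀), fun ξ => ?_⟩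
  by_cases hξ : ξ ∈ K
  · exact (min_le_right _ _).trans (hξ₀ (mem_insert_of_mem 0 hξ))
  · exact (min_le_left _ _).trans (hKsub hξ)

/-- Coercivity of `f ↦ f + k ⋆ f` when the symbol `1 + k̂` is bounded below. -/
theorem mul_integral_sq_le_of_le_one_add_re_fourier {k f : ℝ → ℝ} {c : ℝ}
    (hk : Integrable k) (hc : ∀ ξ : ℝ, c ≤ 1 + (𝓕 (fun t => (k t : ℂ)) ξ).re)
    (hf1 : Integrable f) (hf2 : MemLp f 2) :
    c * ∫ t, f t ^ 2 ≤ ∫ t, f t * (f t + ∫ u, f u * k (t - u)) := by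
  set h : ℝ → ℝ := fun t => ∫ u, f u * k (t - u) with hh
  have hh1 : Integrable h := by
    simpa only [hh, convolution_def] using! hf1.integrable_convolution (.mul ℝ ℝ) hk
  have hh2 : MemLp h 2 := (memLp_two_convolution hf2 hk).2.1
  have hhc : (fun t => (h t : ℂ)) =
      (fun t => (f t : ℂ)) ⋆[ContinuousLinearMap.mul ℂ ℂ] (fun t => (k t : ℂ)) := by
    ext t
    simp only [hh, convolution, ContinuousLinearMap.mul_apply']
    rw [← integral_complex_ofReal]
    push_cast
    rfl
  have hf1c : Integrable fun t => (f t : ℂ) := hf1.ofReal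
  have hh1c : Integrable fun t => (h t : ℂ) := hh1.ofReal
  have hkc : Integrable fun t => (k t : ℂ) := hk.ofReal
  have hF (ξ : ℝ) : 𝓕 (fun t => ((f t + h t : ℝ) : ℂ)) ξ =
      𝓕 (fun t => (f t : ℂ)) ξ * (1 + 𝓕 (fun t => (k t : ℂ)) ξ) := by
    have hadd : 𝓕 (fun t => ((f t + h t : ℝ) : ℂ)) ξ =
        𝓕 (fun t => (f t : ℂ)) ξ + 𝓕 (fun t => (h t : ℂ)) ξ := by
      push_cast
      exact congrFun (VectorFourier.fourierIntegral_add (L := innerₗ ℝ)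
        Real.continuous_fourierChar continuous_inner hf1c hh1c) ξ
    rw [hadd, hhc, Real.fourier_mul_convolution_eq hf1c hkc]
    ring
  obtain ⟨hi1, he1⟩ := integrable_inner_fourier_and_integral_eq hf1c hf2.ofReal hf1c hf2.ofReal
  obtain ⟨hi2, he2⟩ := integrable_inner_fourier_and_integral_eq hf1c hf2.ofReal
    (hf1.add hh1).ofReal (hf2.add hh2).ofReal
  have hR (g : ℝ → ℝ) : (∫ t, inner ℂ (f t : ℂ) (g t : ℂ)).re = ∫ t, f t * g t := by
    have : (fun t => inner ℂ (f t : ℂ) (g t : ℂ)) = fun t => ((f t * g t : ℝ) : ℂ) := by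
      ext t
      simp [mul_comm]
    rw [this, integral_complex_ofReal, Complex.ofReal_re]
  have hre {g : ℝ → ℂ} (hg : Integrable g) : (∫ ξ, g ξ).re = ∫ ξ, (g ξ).re :=
    (integral_re hg).symm
  have e1 := (hR f).symm.trans ((congrArg Complex.re he1).symm.trans (hre hi1))
  have e2 := (hR (f + h)).symm.trans ((congrArg Complex.re he2).symm.trans (hre hi2))
  simp only [Pi.add_apply] at e2
  simp only [pow_two]
  rw [e1, e2, ← integral_const_mul]
  refine integral_mono (hi1.re.const_mul c) hi2.re fun ξ => ?_
  have hz (z w : ℂ) : (inner ℂ z (z * (1 + w))).re = (1 + w.re) * (inner ℂ z z).re := by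
    simp only [RCLike.inner_apply, Complex.mul_re, Complex.mul_im, Complex.add_re, Complex.add_im,
      Complex.one_re, Complex.one_im, Complex.conj_re, Complex.conj_im]
    ring
  have hz0 (z : ℂ) : 0 ≤ (inner ℂ z z).re := inner_self_nonneg (𝕜 := ℂ) (x := z)
  change c * (inner ℂ _ _).re ≤ (inner ℂ _ (𝓕 (fun t => ((f t + h t : ℝ) : ℂ)) ξ)).re
  rw [hF, hz]
  exact mul_le_mul_of_nonneg_right (hc ξ) (hz0 _)

/-- Stability: an `L²` bound for functions `f` satisfying `f + k ⋆ f = k ⋆ γ` a.e. where `f ≠ 0`. -/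
theorem sq_mul_integral_sq_le_of_equation {k f γ : ℝ → ℝ} {c : ℝ} (hc0 : 0 < c)
    (hk : Integrable k) (hc : ∀ ξ : ℝ, c ≤ 1 + (𝓕 (fun t => (k t : ℂ)) ξ).re)
    (hf1 : Integrable f) (hf2 : MemLp f 2) (hγ : MemLp γ 2)
    (heq : ∀ᵐ t, f t ≠ 0 → f t + ∫ u, f u * k (t - u) = ∫ u, γ u * k (t - u)) :
    c ^ 2 * ∫ t, f t ^ 2 ≤ (∫ t, |k t|) ^ 2 * ∫ t, γ t ^ 2 := by
  obtain ⟨-, hg2, hgle⟩ := memLp_two_convolution hγ hk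
  set g : ℝ → ℝ := fun t => ∫ u, γ u * k (t - u)
  have hcoer := mul_integral_sq_le_of_le_one_add_re_fourier hk hc hf1 hf2
  have hfg : ∫ t, f t * (f t + ∫ u, f u * k (t - u)) = ∫ t, f t * g t := by
    refine integral_congr_ae ?_
    filter_upwards [heq] with t ht
    by_cases h0 : f t = 0
    · simp [h0]
    · simp only [ht h0, g]
  rw [hfg] at hcoer
  have hle : ∫ t, 2 * c * (f t * g t) ≤ ∫ t, (c ^ 2 * f t ^ 2 + g t ^ 2) := by
    refine integral_mono ((hf2.integrable_mul hg2).const_mul _)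
      ((hf2.integrable_sq.const_mul _).add hg2.integrable_sq) fun t => ?_
    nlinarith [sq_nonneg (c * f t - g t)]
  rw [integral_const_mul, integral_add (hf2.integrable_sq.const_mul _) hg2.integrable_sq,
    integral_const_mul] at hle
  nlinarith

theorem tendsto_integral_indicator_Ici_sq {γ : ℝ → ℝ} (hγ : MemLp γ 2) :
    Tendsto (fun x : ℝ => ∫ t, (Ici x).indicator γ t ^ 2) atTop (nhds 0) := by
  have h := tendsto_integral_filter_of_dominated_convergence (μ := volume) (l := atTop)
    (F := fun (x : ℝ) t => (Ici x).indicator γ t ^ 2) (f := fun _ => (0 : ℝ))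
    (fun t => γ t ^ 2)
    (Eventually.of_forall fun x =>
      (hγ.aestronglyMeasurable.indicator measurableSet_Ici).pow 2)
    (Eventually.of_forall fun x => ae_of_all _ fun t => ?_) hγ.integrable_sq
    (ae_of_all _ fun t => ?_)
  · simpa using h
  · by_cases ht : t ∈ Ici x <;> simp [ht, sq_nonneg]
  · refine tendsto_const_nhds.congr' ?_
    filter_upwards [eventually_gt_atTop t] with x hx
    simp [hx]


/-- **Convergence of truncated solutions (Theorem 1.4).**
Let `H : ℝ → ℝ` be even, `H ∈ L¹(ℝ) ∩ L²(ℝ)`, with `1 + Ĥ(k) > 0` for all `k`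
(here `Ĥ(k) = ∫ H(t) cos(kt) dt`, which equals `∫ H(t) e^{ikt} dt` since `H`
is real and even). If `Γ ∈ L¹((0,∞)) ∩ L^∞((0,∞))` solves Krein's limiting
equation `Γ(t) + ∫₀^∞ H(t-u) Γ(u) du = H(t)` a.e. on `(0,∞)` and, for each
`x > 0`, `Γₓ ∈ L²((0,x))` solves the truncated equation
`Γₓ(t) + ∫₀ˣ H(t-u) Γₓ(u) du = H(t)` a.e. on `(0,x)`, then
`∫₀ˣ |Γₓ(t) - Γ(t)|² dt → 0` as `x → ∞`. -/
theorem krein_truncated_solutions_converge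
    (H : ℝ → ℝ)
    (heven : ∀ t : ℝ, H (-t) = H t)
    (hL1 : Integrable H (volume : Measure ℝ))
    (hL2 : MemLp H 2 (volume : Measure ℝ))
    (hpos : ∀ k : ℝ, 0 < 1 + ∫ t : ℝ, H t * Real.cos (k * t))
    (Γ : ℝ → ℝ)
    (hΓ1 : IntegrableOn Γ (Ioi 0))
    (hΓinf : MemLp Γ ⊤ (volume.restrict (Ioi 0)))
    (hΓeq : ∀ᵐ t ∂(volume.restrict (Ioi 0)),
      Γ t + ∫ u in Ioi (0:ℝ), H (t - u) * Γ u = H t)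
    (Γfam : ℝ → ℝ → ℝ)
    (hfam2 : ∀ x : ℝ, 0 < x → MemLp (Γfam x) 2 (volume.restrict (Ioo 0 x)))
    (hfameq : ∀ x : ℝ, 0 < x → ∀ᵐ t ∂(volume.restrict (Ioo 0 x)),
      Γfam x t + ∫ u in Ioo 0 x, H (t - u) * Γfam x u = H t) :
    Tendsto (fun x : ℝ => ∫ t in Ioo 0 x, |Γfam x t - Γ t| ^ 2)
      atTop (nhds 0) := by
  obtain ⟨c, hc0, hc⟩ := exists_pos_le_one_add_re_fourier hL1 hpos
  set γ : ℝ → ℝ := (Ioi 0).indicator Γ with hγdef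
  have hγ2 : MemLp γ 2 := by
    rw [hγdef, memLp_indicator_iff_restrict measurableSet_Ioi]
    rw [memLp_two_iff_integrable_sq hΓinf.aestronglyMeasurable]
    have := hΓ1.integrable.mul_of_top_right hΓinf
    simpa only [pow_two] using! this
  have hbound (x : ℝ) (hx : 0 < x) : ∫ t in Ioo 0 x, |Γfam x t - Γ t| ^ 2 ≤
      (∫ t, |H t|) ^ 2 / c ^ 2 * ∫ t, (Ici x).indicator γ t ^ 2 := by
    set f : ℝ → ℝ := (Ioo 0 x).indicator (fun t => Γfam x t - Γ t) with hfdef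
    set φ : ℝ → ℝ := (Ioo 0 x).indicator (Γfam x) with hφdef
    have hφ2 : MemLp φ 2 := by
      rw [hφdef, memLp_indicator_iff_restrict measurableSet_Ioo]
      exact hfam2 x hx
    have hfγ : f = φ - γ + (Ici x).indicator γ := by
      ext t
      simp only [hfdef, hφdef, hγdef, Pi.add_apply, Pi.sub_apply, indicator, mem_Ioo, mem_Ioi,
        mem_Ici]
      split_ifs <;> grind
    have hτ2 : MemLp ((Ici x).indicator γ) 2 := hγ2.indicator measurableSet_Ici
    have hf2 : MemLp f 2 := by
      rw [hfγ]
      exact (hφ2.sub hγ2).add hτ2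
    have hf1 : Integrable f := by
      have h : MemLp f 2 (volume.restrict (Ioo 0 x)) := hf2.restrict _
      have h' := h.integrable (by norm_num)
      rw [hfdef, integrable_indicator_iff measurableSet_Ioo]
      refine IntegrableOn.congr_fun h' (fun t ht => ?_) measurableSet_Ioo
      simp [hfdef, ht]
    have hset {s : Set ℝ} (hs : MeasurableSet s) (g : ℝ → ℝ) (t : ℝ) :
        ∫ u in s, H (t - u) * g u = ∫ u, s.indicator g u * H (t - u) := by
      rw [← integral_indicator hs]
      refine integral_congr_ae (ae_of_all _ fun u => ?_)
      by_cases hu : u ∈ s <;> simp [hu, mul_comm]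
    have heq : ∀ᵐ t, f t ≠ 0 →
        f t + ∫ u, f u * H (t - u) = ∫ u, (Ici x).indicator γ u * H (t - u) := by
      filter_upwards [(ae_restrict_iff' measurableSet_Ioi).1 hΓeq,
        (ae_restrict_iff' measurableSet_Ioo).1 (hfameq x hx),
        (memLp_two_convolution hφ2 hL1).1, (memLp_two_convolution hγ2 hL1).1,
        (memLp_two_convolution hτ2 hL1).1] with t h1 h2 i1 i2 i3 ht
      have htx : t ∈ Ioo 0 x := mem_of_indicator_ne_zero ht
      have e1 := h1 htx.1
      have e2 := h2 htx
      rw [hset measurableSet_Ioi] at e1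
      rw [hset measurableSet_Ioo] at e2
      have e3 : ∫ u, f u * H (t - u) = (∫ u, φ u * H (t - u)) - (∫ u, γ u * H (t - u)) +
          ∫ u, (Ici x).indicator γ u * H (t - u) := by
        rw [← integral_sub i1 i2, ← integral_add (by fun_prop) i3]
        refine integral_congr_ae (ae_of_all _ fun u => ?_)
        simp only [hfγ, Pi.add_apply, Pi.sub_apply]
        ring
      have e4 : f t = Γfam x t - Γ t := by simp [hfdef, htx]
      rw [e3, e4]
      linarith
    have hmain := sq_mul_integral_sq_le_of_equation hc0 hL1 hc hf1 hf2 hτ2 heq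
    have hint : ∫ t in Ioo 0 x, |Γfam x t - Γ t| ^ 2 = ∫ t, f t ^ 2 := by
      rw [← integral_indicator measurableSet_Ioo]
      refine integral_congr_ae (ae_of_all _ fun t => ?_)
      by_cases ht : t ∈ Ioo 0 x <;> simp [hfdef, ht]
    rw [hint, div_mul_eq_mul_div, le_div_iff₀ (by positivity)]
    linarith
  refine squeeze_zero' (Eventually.of_forall fun x => integral_nonneg fun t => by positivity)
    ((eventually_gt_atTop 0).mono hbound) ?_
  simpa using (tendsto_integral_indicator_Ici_sq hγ2).const_mul ((∫ t, |H t|) ^ 2 / c ^ 2)
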